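/- arXiv:2011.09915 — 5 statements merged into one kernel-verified Lean document; each statement's English description precedes it below -/
import Mathlib

section
/- Let (e_j)_{j∈ℕ} be a normalized (C_u,C_s)-subsymmetric Schauder basis of a Banach space X with biorthogonal functionals (e_j*), and let T : X → X be a bounded linear operator whose diagonal satisfies δ := inf_j |⟨T e_j, e_j*⟩| > 0. Then for every η > 0 there exist bounded linear operators A, B : X → X with I_X = A T B and ‖A‖·‖B‖ ≤ 2·C_u^5·C_s^3/δ + η (i.e., (e_j) has the (2C_u^5C_s^3/δ)-factorization property). -/
open Filter Topology

/-- The series `∑ u j` converges in norm to `x` (ordered partial sums). -/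
def NormHasSum {X : Type*} [NormedAddCommGroup X] [NormedSpace ℝ X]
    (u : ℕ → X) (x : X) : Prop :=
  Tendsto (fun n => ∑ j ∈ Finset.range n, u j) atTop (𝓝 x)

/-- `(e j)` is `Cu`-unconditional: for all scalar sequences `(a j)`, `(γ j)` with
norm-convergent series, `‖∑ γ j * a j • e j‖ ≤ Cu * sup_k |γ k| * ‖∑ a j • e j‖`. -/
def NormUncond {X : Type*} [NormedAddCommGroup X] [NormedSpace ℝ X]
    (e : ℕ → X) (Cu : ℝ) : Prop :=
  ∀ (a γ : ℕ → ℝ) (x x' : X), BddAbove (Set.range fun k => |γ k|) →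
    NormHasSum (fun j => a j • e j) x →
    NormHasSum (fun j => (γ j * a j) • e j) x' →
    ‖x'‖ ≤ Cu * (⨆ k, |γ k|) * ‖x‖

/-- `(e j)` is `Cs`-spreading: it is `Cs`-equivalent to each of its increasing
subsequences (for norm-convergent series). -/
def NormSpreading {X : Type*} [NormedAddCommGroup X] [NormedSpace ℝ X]
    (e : ℕ → X) (Cs : ℝ) : Prop :=
  ∀ (a : ℕ → ℝ) (m : ℕ → ℕ), StrictMono m → ∀ (x x' : X),
    NormHasSum (fun j => a j • e j) x →
    NormHasSum (fun j => a j • e (m j)) x' →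
    (1 / Cs) * ‖x'‖ ≤ ‖x‖ ∧ ‖x‖ ≤ Cs * ‖x'‖

theorem CauchySeq.of_norm_sub_le {X : Type*} [SeminormedAddCommGroup X] {u v : ℕ → X}
    (hv : CauchySeq v) {C : ℝ} (hC : 0 ≤ C)
    (h : ∀ m n, m ≤ n → ‖u n - u m‖ ≤ C * ‖v n - v m‖) : CauchySeq u := by
  rw [Metric.cauchySeq_iff'] at hv ⊢
  intro ε hε
  obtain ⟨N, hN⟩ := hv (ε / (C + 1)) (by positivity)
  refine ⟨N, fun n hn => ?_⟩
  have h1 := hN n hn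
  rw [dist_eq_norm] at h1 ⊢
  rw [lt_div_iff₀ (by positivity)] at h1
  have := norm_nonneg (v n - v N)
  linarith [h N n hn]

section FiniteSums

variable {X : Type*} [NormedAddCommGroup X] [NormedSpace ℝ X]

theorem NormHasSum.of_support_subset {u : ℕ → X} {s : Finset ℕ} (h : ∀ j, j ∉ s → u j = 0) :
    NormHasSum u (∑ j ∈ s, u j) :=
  (hasSum_sum_of_ne_finset_zero fun j hj => h j hj).tendsto_sum_nat

theorem NormUncond.one_le {e : ℕ → X} {Cu : ℝ} (hu : NormUncond e Cu) (hnorm : ∀ j, ‖e j‖ = 1) :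
    1 ≤ Cu := by
  have h0 : NormHasSum (fun j => (Pi.single 0 1 : ℕ → ℝ) j • e j) (e 0) := by
    have := NormHasSum.of_support_subset (u := fun j => (Pi.single 0 1 : ℕ → ℝ) j • e j)
      (s := {0}) (by intro j hj; simp at hj; simp [hj])
    simpa using this
  have := hu (Pi.single 0 1) (fun _ => 1) (e 0) (e 0) (by simp) h0 (by simpa using h0)
  simpa [hnorm] using this

theorem NormSpreading.one_le {e : ℕ → X} {Cs : ℝ} (hs : NormSpreading e Cs)
    (hnorm : ∀ j, ‖e j‖ = 1) : 1 ≤ Cs := by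
  have h0 : NormHasSum (fun j => (Pi.single 0 1 : ℕ → ℝ) j • e j) (e 0) := by
    have := NormHasSum.of_support_subset (u := fun j => (Pi.single 0 1 : ℕ → ℝ) j • e j)
      (s := {0}) (by intro j hj; simp at hj; simp [hj])
    simpa using this
  have := (hs (Pi.single 0 1) id strictMono_id (e 0) (e 0) h0 (by simpa using h0)).2
  simpa [hnorm] using this

theorem NormSpreading.norm_sum_le {e : ℕ → X} {Cs : ℝ} (hs : NormSpreading e Cs) (hCs : 0 < Cs)
    (a : ℕ → ℝ) {m : ℕ → ℕ} (hm : StrictMono m) (s : Finset ℕ) :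
    ‖∑ j ∈ s, a j • e (m j)‖ ≤ Cs * ‖∑ j ∈ s, a j • e j‖ ∧
      ‖∑ j ∈ s, a j • e j‖ ≤ Cs * ‖∑ j ∈ s, a j • e (m j)‖ := by
  classical
  set b : ℕ → ℝ := fun j => if j ∈ s then a j else 0 with hb
  have key : ∀ v : ℕ → X, NormHasSum (fun j => b j • v j) (∑ j ∈ s, a j • v j) := by
    intro v
    have h := NormHasSum.of_support_subset (u := fun j => b j • v j) (s := s)
      (by intro j hj; simp [hb, hj])
    rwa [Finset.sum_congr rfl (g := fun j => a j • v j)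
      (by intro j hj; simp [hb, hj])] at h
  obtain ⟨h1, h2⟩ := hs b m hm _ _ (key e) (key fun j => e (m j))
  refine ⟨?_, h2⟩
  rwa [one_div, inv_mul_le_iff₀ hCs] at h1

theorem NormUncond.norm_sum_le {e : ℕ → X} {Cu : ℝ} (hu : NormUncond e Cu) (hCu : 0 ≤ Cu)
    {f : ℕ → X →L[ℝ] ℝ} (hexp : ∀ x : X, NormHasSum (fun j => f j x • e j) x)
    (x : X) {p : ℕ → ℕ} (hp : Function.Injective p) (s : Finset ℕ) (γ : ℕ → ℝ) {M : ℝ}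
    (hM : 0 ≤ M) (hγ : ∀ j ∈ s, |γ j| ≤ M) :
    ‖∑ j ∈ s, (γ j * f (p j) x) • e (p j)‖ ≤ Cu * M * ‖x‖ := by
  classical
  set g : ℕ → ℝ := fun k => if k ∈ s.image p then γ (Function.invFun p k) else 0 with hg
  have hgp : ∀ j ∈ s, g (p j) = γ j := by
    intro j hj
    have : p j ∈ s.image p := Finset.mem_image_of_mem _ hj
    simp only [hg, this, if_true, Function.leftInverse_invFun hp j]
  have hgM : ∀ k, |g k| ≤ M := by
    intro k
    by_cases hk : k ∈ s.image p
    · obtain ⟨j, hj, rfl⟩ := Finset.mem_image.1 hk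
      rw [hgp j hj]; exact hγ j hj
    · simp only [hg, hk, if_false, abs_zero, hM]
  have h := NormHasSum.of_support_subset (u := fun k => (g k * f k x) • e k) (s := s.image p)
    (by intro k hk; simp only [hg, hk, if_false, zero_mul, zero_smul])
  rw [Finset.sum_image (fun a _ b _ hab => hp hab),
    Finset.sum_congr rfl (g := fun j => (γ j * f (p j) x) • e (p j))
      (by intro j hj; rw [hgp j hj])] at h
  refine (hu (fun k => f k x) g x _ ⟨M, by rintro _ ⟨k, rfl⟩; exact hgM k⟩ (hexp x) h).trans ?_
  gcongr
  exact ciSup_le hgM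

theorem NormUncond.abs_coord_le {e : ℕ → X} {Cu : ℝ} (hu : NormUncond e Cu) (hCu : 0 ≤ Cu)
    (hnorm : ∀ j, ‖e j‖ = 1)
    {f : ℕ → X →L[ℝ] ℝ} (hexp : ∀ x : X, NormHasSum (fun j => f j x • e j) x)
    (j : ℕ) (x : X) : |f j x| ≤ Cu * ‖x‖ := by
  have := hu.norm_sum_le hCu hexp x Function.injective_id {j} (fun _ => 1) zero_le_one (by simp)
  simpa [norm_smul, hnorm] using this

theorem coord_sum {e : ℕ → X} {f : ℕ → X →L[ℝ] ℝ}
    (hbi : ∀ j k, f j (e k) = if k = j then 1 else 0) (a : ℕ → ℝ) (s : Finset ℕ) {j : ℕ}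
    (hj : j ∈ s) : f j (∑ k ∈ s, a k • e k) = a j := by
  simp [map_sum, hbi, hj]

theorem tendsto_coord_atTop {e : ℕ → X} (hnorm : ∀ j, ‖e j‖ = 1)
    {f : ℕ → X →L[ℝ] ℝ} (hexp : ∀ x : X, NormHasSum (fun j => f j x • e j) x) (x : X) :
    Tendsto (fun j => f j x) atTop (𝓝 0) := by
  have h : Tendsto (fun n => ∑ j ∈ Finset.range (n + 1), f j x • e j -
      ∑ j ∈ Finset.range n, f j x • e j) atTop (𝓝 (x - x)) :=
    ((tendsto_add_atTop_iff_nat 1).2 (hexp x)).sub (hexp x)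
  rw [sub_self] at h
  rw [tendsto_zero_iff_norm_tendsto_zero] at h ⊢
  simpa [Finset.sum_range_succ, norm_smul, hnorm] using h

theorem norm_sub_self_le_of_basis {e : ℕ → X} {f : ℕ → X →L[ℝ] ℝ}
    (hexp : ∀ x : X, NormHasSum (fun j => f j x • e j) x) {C D : ℝ} (hC : 0 ≤ C) (hD : 0 ≤ D)
    (hf : ∀ j x, |f j x| ≤ C * ‖x‖) (S : X →L[ℝ] X)
    (hS : ∀ j, ‖S (e j) - e j‖ ≤ D * (1 / 2) ^ j) (x : X) :
    ‖S x - x‖ ≤ C * D * 2 * ‖x‖ := by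
  have hlim : Tendsto (fun n => ∑ j ∈ Finset.range n, f j x • (S (e j) - e j)) atTop
      (𝓝 (S x - x)) := by
    have := ((S.continuous.tendsto x).comp (hexp x)).sub (hexp x)
    simpa [Function.comp_def, smul_sub, Finset.sum_sub_distrib] using this
  refine le_of_tendsto hlim.norm (Eventually.of_forall fun n => ?_)
  calc ‖∑ j ∈ Finset.range n, f j x • (S (e j) - e j)‖
      ≤ ∑ j ∈ Finset.range n, C * ‖x‖ * (D * (1 / 2) ^ j) := by
        refine norm_sum_le_of_le _ fun j _ => ?_
        rw [norm_smul, Real.norm_eq_abs]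
        gcongr
        · exact hf j x
        · exact hS j
    _ = C * D * ‖x‖ * ∑ j ∈ Finset.range n, (1 / 2 : ℝ) ^ j := by
        rw [Finset.mul_sum]
        exact Finset.sum_congr rfl fun j _ => by ring
    _ ≤ C * D * ‖x‖ * 2 := by
        gcongr
        exact sum_geometric_two_le n
    _ = C * D * 2 * ‖x‖ := by ring

theorem norm_sub_basis_vector_le {e : ℕ → X} (hnorm : ∀ j, ‖e j‖ = 1) {a : ℕ → ℝ} {y : X}
    (hy : NormHasSum (fun i => a i • e i) y) {j : ℕ} (hj : a j = 1) {D : ℝ} (hD : 0 ≤ D)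
    (ha : ∀ i, i ≠ j → |a i| ≤ D * (1 / 2) ^ i) : ‖y - e j‖ ≤ D * 2 := by
  refine le_of_tendsto (hy.sub_const (e j)).norm ?_
  filter_upwards [eventually_gt_atTop j] with n hn
  rw [← Finset.add_sum_erase _ _ (Finset.mem_range.2 hn), hj, one_smul, add_sub_cancel_left]
  calc ‖∑ i ∈ (Finset.range n).erase j, a i • e i‖
      ≤ ∑ i ∈ (Finset.range n).erase j, D * (1 / 2) ^ i := by
        refine norm_sum_le_of_le _ fun i hi => ?_
        rw [norm_smul, hnorm, mul_one]
        exact ha i (Finset.ne_of_mem_erase hi)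
    _ ≤ ∑ i ∈ Finset.range n, D * (1 / 2) ^ i :=
        Finset.sum_le_sum_of_subset_of_nonneg (Finset.erase_subset _ _)
          fun i _ _ => by positivity
    _ ≤ D * 2 := by
        rw [← Finset.mul_sum]
        gcongr
        exact sum_geometric_two_le n

end FiniteSums

section Operators

variable {X : Type*} [NormedAddCommGroup X] [NormedSpace ℝ X] [CompleteSpace X]

theorem exists_clm_of_cauchySeq_partial_sums (g : ℕ → X →L[ℝ] ℝ) (v : ℕ → X) {C : ℝ} (hC : 0 ≤ C)
    (hcau : ∀ x, CauchySeq fun n => ∑ j ∈ Finset.range n, g j x • v j)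
    (hbound : ∀ x n, ‖∑ j ∈ Finset.range n, g j x • v j‖ ≤ C * ‖x‖) :
    ∃ S : X →L[ℝ] X, (∀ x, NormHasSum (fun j => g j x • v j) (S x)) ∧ ‖S‖ ≤ C := by
  choose S hS using fun x => cauchySeq_tendsto_of_complete (hcau x)
  have hlim : Tendsto (fun n x => (∑ j ∈ Finset.range n, (g j).smulRight (v j)) x) atTop (𝓝 S) := by
    rw [tendsto_pi_nhds]
    intro x
    simpa using hS x
  refine ⟨continuousLinearMapOfTendsto _ hlim, hS, ?_⟩
  refine ContinuousLinearMap.opNorm_le_bound _ hC fun x => ?_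
  exact le_of_tendsto (hS x).norm (Eventually.of_forall (hbound x))

theorem exists_spreading_clm {e : ℕ → X} {f : ℕ → X →L[ℝ] ℝ}
    (hexp : ∀ x : X, NormHasSum (fun j => f j x • e j) x)
    {Cu Cs : ℝ} (hu : NormUncond e Cu) (hCu : 0 ≤ Cu) (hs : NormSpreading e Cs) (hCs : 0 < Cs)
    {p : ℕ → ℕ} (hp : StrictMono p) :
    ∃ S : X →L[ℝ] X, (∀ x, NormHasSum (fun j => f j x • e (p j)) (S x)) ∧
      ∀ x, ‖S x‖ ≤ Cs * ‖x‖ := by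
  obtain ⟨S, hS, -⟩ := exists_clm_of_cauchySeq_partial_sums f (fun j => e (p j))
    (C := Cs * (Cu * 1)) (by positivity)
    (fun x => (hexp x).cauchySeq.of_norm_sub_le hCs.le fun m n hmn => by
      rw [← Finset.sum_Ico_eq_sub _ hmn, ← Finset.sum_Ico_eq_sub _ hmn]
      exact (hs.norm_sum_le hCs _ hp _).1)
    (fun x n => by
      refine (hs.norm_sum_le hCs _ hp _).1.trans ?_
      rw [mul_assoc]
      gcongr
      simpa using hu.norm_sum_le hCu hexp x Function.injective_id (Finset.range n) (fun _ => 1)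
        zero_le_one (by simp))
  refine ⟨S, hS, fun x => ?_⟩
  exact le_of_tendsto_of_tendsto' (hS x).norm ((hexp x).norm.const_mul Cs)
    fun n => (hs.norm_sum_le hCs _ hp _).1

theorem exists_compression_clm {e : ℕ → X} {f : ℕ → X →L[ℝ] ℝ}
    (hbi : ∀ j k, f j (e k) = if k = j then 1 else 0)
    (hexp : ∀ x : X, NormHasSum (fun j => f j x • e j) x)
    {Cu Cs : ℝ} (hu : NormUncond e Cu) (hCu : 0 ≤ Cu) (hs : NormSpreading e Cs) (hCs : 0 < Cs)
    {p : ℕ → ℕ} (hp : StrictMono p) (γ : ℕ → ℝ) {M : ℝ} (hM : 0 ≤ M) (hγ : ∀ j, |γ j| ≤ M) :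
    ∃ S : X →L[ℝ] X, (∀ x, NormHasSum (fun j => (γ j * f (p j) x) • e j) (S x)) ∧
      ‖S‖ ≤ Cs * (Cu * M) := by
  have hfin : ∀ (x : X) (s : Finset ℕ),
      ‖∑ j ∈ s, (γ j * f (p j) x) • e j‖ ≤ Cs * (Cu * M) * ‖x‖ := by
    intro x s
    refine (hs.norm_sum_le hCs _ hp _).2.trans ?_
    rw [mul_assoc]
    gcongr
    exact hu.norm_sum_le hCu hexp x hp.injective s γ hM fun j _ => hγ j
  refine exists_clm_of_cauchySeq_partial_sums (fun j => γ j • f (p j)) e (by positivity) ?_ ?_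
  · intro x
    refine CauchySeq.of_norm_sub_le (v := fun n => ∑ k ∈ Finset.range (p n), f k x • e k)
      ((hexp x).comp hp.tendsto_atTop).cauchySeq (C := Cs * (Cu * M)) (by positivity) ?_
    intro m n hmn
    rw [← Finset.sum_Ico_eq_sub _ hmn, ← Finset.sum_Ico_eq_sub _ (hp.monotone hmn)]
    refine le_trans (le_of_eq ?_)
      (hfin (∑ k ∈ Finset.Ico (p m) (p n), f k x • e k) (Finset.Ico m n))
    congr 1
    refine Finset.sum_congr rfl fun j hj => ?_
    rw [coord_sum hbi]
    · simp
    · rw [Finset.mem_Ico] at hj ⊢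
      exact ⟨hp.monotone hj.1, hp hj.2⟩
  · intro x n
    simpa using hfin x (Finset.range n)

theorem exists_left_inverse_of_near_id (S : X →L[ℝ] X) {κ : ℝ} (hκ0 : 0 ≤ κ) (hκ : κ < 1)
    (h : ∀ x, ‖S x - x‖ ≤ κ * ‖x‖) :
    ∃ V : X →L[ℝ] X, V.comp S = ContinuousLinearMap.id ℝ X ∧ ‖V‖ ≤ 1 / (1 - κ) := by
  have hE : ‖(1 : X →L[ℝ] X) - S‖ ≤ κ :=
    ContinuousLinearMap.opNorm_le_bound _ hκ0 fun x => by
      simpa [norm_sub_rev] using h x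
  set U := Units.oneSub (1 - S) (hE.trans_lt hκ) with hU
  have hUS : (U : X →L[ℝ] X) = S := by simp [hU]
  have hinv : ((U⁻¹ : (X →L[ℝ] X)ˣ) : X →L[ℝ] X) * S = 1 := by rw [← hUS, U.inv_mul]
  have hinv' : S * ((U⁻¹ : (X →L[ℝ] X)ˣ) : X →L[ℝ] X) = 1 := by rw [← hUS, U.mul_inv]
  refine ⟨((U⁻¹ : (X →L[ℝ] X)ˣ) : X →L[ℝ] X), hinv, ?_⟩
  refine ContinuousLinearMap.opNorm_le_bound _ (by have : 0 < 1 - κ := by linarith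
                                                   positivity) fun x => ?_
  set y := ((U⁻¹ : (X →L[ℝ] X)ˣ) : X →L[ℝ] X) x with hy
  have hSy : S y = x := by
    have := DFunLike.congr_fun hinv' x
    simpa using this
  have h1 := h y
  rw [hSy] at h1
  have h2 : ‖y‖ ≤ ‖x‖ + ‖x - y‖ := by
    simpa using norm_sub_le x (x - y)
  rw [one_div, ← div_eq_inv_mul, le_div_iff₀ (by linarith)]
  linarith

end Operators

section Selection

variable {X : Type*} [NormedAddCommGroup X] [NormedSpace ℝ X]

theorem exists_subseq_tendsto_coord {f : ℕ → X →L[ℝ] ℝ} {y : ℕ → X} {C : ℝ}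
    (hy : ∀ j, ‖y j‖ ≤ C) :
    ∃ (c : ℕ → ℝ) (φ : ℕ → ℕ), StrictMono φ ∧
      ∀ i, Tendsto (fun j => f i (y (φ j))) atTop (𝓝 (c i)) := by
  obtain ⟨c, -, φ, hφ, h⟩ := (isCompact_univ_pi fun i =>
    isCompact_Icc (a := -(‖f i‖ * C)) (b := ‖f i‖ * C)).tendsto_subseq
    (x := fun j i => f i (y j)) (by
      intro j i _
      rw [Set.mem_Icc, ← abs_le, ← Real.norm_eq_abs]
      exact ((f i).le_opNorm _).trans (by gcongr; exact hy j))
  exact ⟨c, φ, hφ, fun i => (tendsto_pi_nhds.1 h) i⟩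

theorem tendsto_limit_coord_zero {e : ℕ → X} {f : ℕ → X →L[ℝ] ℝ}
    (hnorm : ∀ j, ‖e j‖ = 1)
    (hbi : ∀ j k, f j (e k) = if k = j then 1 else 0)
    (hexp : ∀ x : X, NormHasSum (fun j => f j x • e j) x)
    {Cu Cs : ℝ} (hu : NormUncond e Cu) (hCu : 0 ≤ Cu) (hs : NormSpreading e Cs) (hCs : 0 < Cs)
    (T : X →L[ℝ] X) {c : ℕ → ℝ} {φ : ℕ → ℕ} (hφ : StrictMono φ)
    (hc : ∀ i, Tendsto (fun j => f i (T (e (φ j)))) atTop (𝓝 (c i))) :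
    Tendsto c atTop (𝓝 0) := by
  by_contra hcon
  obtain ⟨ε, hε, hfreq⟩ : ∃ ε > 0, ∃ᶠ n in atTop, ε ≤ |c n| := by
    rw [Metric.tendsto_nhds] at hcon
    push Not at hcon
    simpa using hcon
  obtain ⟨ψ, hψ, hψε⟩ := extraction_of_frequently_atTop hfreq
  have hbd : ∀ N, ‖∑ i ∈ Finset.range N, c (ψ i) • e (ψ i)‖ ≤ Cu * ‖T‖ := by
    intro N
    have hlim : Tendsto (fun j => ∑ i ∈ Finset.range N, f (ψ i) (T (e (φ j))) • e (ψ i)) atTop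
        (𝓝 (∑ i ∈ Finset.range N, c (ψ i) • e (ψ i))) :=
      tendsto_finsetSum _ fun i _ => (hc (ψ i)).smul_const _
    refine le_of_tendsto hlim.norm (Eventually.of_forall fun j => ?_)
    have h1 := hu.norm_sum_le hCu hexp (T (e (φ j))) hψ.injective (Finset.range N) (fun _ => 1)
      zero_le_one (by simp)
    have h2 := T.le_opNorm (e (φ j))
    rw [hnorm, mul_one] at h2
    simp only [one_mul, mul_one] at h1
    exact h1.trans (by gcongr)
  have hones : ∀ N, ‖∑ i ∈ Finset.range N, (1 : ℝ) • e (ψ i)‖ ≤ Cu * ε⁻¹ * (Cu * ‖T‖) := by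
    intro N
    have h1 := hu.norm_sum_le hCu hexp (∑ i ∈ Finset.range N, c (ψ i) • e (ψ i)) hψ.injective
      (Finset.range N) (fun i => (c (ψ i))⁻¹) (inv_nonneg.2 hε.le) (by
        intro i _
        rw [abs_inv]
        exact inv_anti₀ hε (hψε i))
    rw [Finset.sum_congr rfl (g := fun i => (1 : ℝ) • e (ψ i))] at h1
    · refine h1.trans ?_
      gcongr
      exact hbd N
    · intro i hi
      congr 1
      have : f (ψ i) (∑ k ∈ Finset.range N, c (ψ k) • e (ψ k)) = c (ψ i) := by
        rw [map_sum, Finset.sum_eq_single i]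
        · simp [hbi]
        · intro k _ hk
          simp [hbi, hψ.injective.eq_iff, hk]
        · exact fun h => absurd hi h
      rw [this, inv_mul_cancel₀]
      intro h0
      have := hψε i
      rw [h0, abs_zero] at this
      linarith
  set K := Cs * (Cs * (Cu * ε⁻¹ * (Cu * ‖T‖))) with hK
  have hall : ∀ (θ : ℕ → ℕ), StrictMono θ →
      ∀ N, ‖∑ i ∈ Finset.range N, (1 : ℝ) • e (θ i)‖ ≤ K := by
    intro θ hθ N
    refine (hs.norm_sum_le hCs (fun _ => 1) hθ _).1.trans ?_
    rw [hK]
    gcongr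
    refine (hs.norm_sum_le hCs (fun _ => 1) hψ _).2.trans ?_
    gcongr
    exact hones N
  set p := ψ 0 with hpdef
  have hp : 0 < c p ^ 2 := by
    rw [sq_pos_iff, ← abs_pos]
    exact hε.trans_le (hψε 0)
  have hev : ∀ᶠ j in atTop, c p ^ 2 / 2 < c p * f p (T (e (φ j))) := by
    refine ((hc p).const_mul (c p)).eventually_const_lt ?_
    nlinarith
  obtain ⟨m, hm⟩ := eventually_atTop.1 hev
  obtain ⟨N, hN⟩ := exists_nat_gt ((|c p| * (‖(f p).comp T‖ * K)) / (c p ^ 2 / 2))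
  rw [div_lt_iff₀ (by positivity)] at hN
  have hlow : (N : ℝ) * (c p ^ 2 / 2) ≤
      c p * f p (T (∑ i ∈ Finset.range N, (1 : ℝ) • e (φ (i + m)))) := by
    simp only [map_sum, one_smul, Finset.mul_sum]
    have := Finset.card_nsmul_le_sum (Finset.range N)
      (fun i => c p * f p (T (e (φ (i + m))))) (c p ^ 2 / 2) (fun i _ => (hm _ (by omega)).le)
    simpa using this
  have hup : c p * f p (T (∑ i ∈ Finset.range N, (1 : ℝ) • e (φ (i + m)))) ≤
      |c p| * (‖(f p).comp T‖ * K) := by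
    refine (le_abs_self _).trans ?_
    rw [abs_mul]
    gcongr
    refine (((f p).comp T).le_opNorm _).trans ?_
    gcongr
    exact hall (fun i => φ (i + m)) (fun a b hab => hφ (by omega)) N
  linarith

theorem exists_almost_diagonal_pairs {e : ℕ → X} {f : ℕ → X →L[ℝ] ℝ}
    (hnorm : ∀ j, ‖e j‖ = 1)
    (hexp : ∀ x : X, NormHasSum (fun j => f j x • e j) x)
    (T : X →L[ℝ] X) {c : ℕ → ℝ} {φ : ℕ → ℕ} (hφ : StrictMono φ)
    (hc : ∀ i, Tendsto (fun j => f i (T (e (φ j)))) atTop (𝓝 (c i)))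
    (hc0 : Tendsto c atTop (𝓝 0)) {ε : ℝ} (hε : 0 < ε) :
    ∃ p q : ℕ → ℕ, StrictMono p ∧ StrictMono q ∧ (∀ n, |f (p n) (T (e (q n)))| ≤ ε) ∧
      ∀ i j, i ≠ j → |f (p i) (T (e (p j) - e (q j)))| ≤ ε * (1 / 2) ^ i * (1 / 2) ^ j := by
  obtain ⟨F, hF, hr⟩ := exists_seq_of_forall_finset_exists
    (P := fun u : ℕ × ℕ × ℕ => u.2.1 < u.2.2 ∧ |f u.2.1 (T (e u.2.2))| ≤ ε)
    (r := fun u v : ℕ × ℕ × ℕ => u.1 < v.1 ∧ u.2.2 < v.2.1 ∧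
      |f v.2.1 (T (e u.2.1 - e u.2.2))| ≤ ε * (1 / 2) ^ v.1 * (1 / 2) ^ u.1 ∧
      |f u.2.1 (T (e v.2.1 - e v.2.2))| ≤ ε * (1 / 2) ^ u.1 * (1 / 2) ^ v.1) (by
    intro s _
    obtain ⟨k, hk⟩ : ∃ k : ℕ, ∀ u ∈ s, u.1 < k :=
      ⟨s.sup Prod.fst + 1, fun u hu => Nat.lt_succ_of_le (Finset.le_sup (f := Prod.fst) hu)⟩
    have hclose : ∀ᶠ m in atTop, ∀ u ∈ s,
        |f u.2.1 (T (e (φ m))) - c u.2.1| < ε * (1 / 2) ^ u.1 * (1 / 2) ^ k / 2 := by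
      rw [Filter.eventually_all_finset]
      intro u _
      have := Metric.tendsto_nhds.1 (hc u.2.1) (ε * (1 / 2) ^ u.1 * (1 / 2) ^ k / 2)
        (by positivity)
      simpa [Real.dist_eq] using this
    have hlarge : ∀ᶠ m in atTop, ∀ u ∈ s, u.2.2 < φ m := by
      rw [Filter.eventually_all_finset]
      exact fun u _ => hφ.tendsto_atTop.eventually_gt_atTop _
    have hcol : ∀ᶠ m in atTop, ∀ u ∈ s,
        |f (φ m) (T (e u.2.1 - e u.2.2))| < ε * (1 / 2) ^ k * (1 / 2) ^ u.1 := by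
      rw [Filter.eventually_all_finset]
      intro u _
      have := Metric.tendsto_nhds.1 ((tendsto_coord_atTop hnorm hexp
        (T (e u.2.1 - e u.2.2))).comp hφ.tendsto_atTop)
        (ε * (1 / 2) ^ k * (1 / 2) ^ u.1) (by positivity)
      simpa only [Real.dist_eq, sub_zero, Function.comp_apply] using this
    have hcε : ∀ᶠ m in atTop, |c (φ m)| < ε := by
      have := Metric.tendsto_nhds.1 (hc0.comp hφ.tendsto_atTop) ε hε
      simpa only [Real.dist_eq, sub_zero, Function.comp_apply] using this
    obtain ⟨m, hm1, hm2, hm3, hm4⟩ := (hclose.and (hlarge.and (hcol.and hcε))).exists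
    obtain ⟨m', hm'1, hm'2, hm'3⟩ := (hclose.and
      ((hφ.tendsto_atTop.eventually_gt_atTop (φ m)).and
        ((hc (φ m)).abs.eventually_lt_const hm4))).exists
    refine ⟨(k, φ m, φ m'), ⟨hm'2, hm'3.le⟩, fun u hu => ⟨hk u hu, hm2 u hu, (hm3 u hu).le, ?_⟩⟩
    have h1 := hm1 u hu
    have h2 := hm'1 u hu
    rw [map_sub, map_sub]
    have h3 := abs_sub_le (f u.2.1 (T (e (φ m)))) (c u.2.1) (f u.2.1 (T (e (φ m'))))
    rw [abs_sub_comm (c u.2.1)] at h3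
    dsimp only
    linarith)
  have hkmono : StrictMono fun n => (F n).1 := strictMono_nat_of_lt_succ fun n =>
    (hr n (n + 1) n.lt_succ_self).1
  have hpow : ∀ n, ((1 : ℝ) / 2) ^ (F n).1 ≤ (1 / 2) ^ n := fun n =>
    pow_le_pow_of_le_one (by norm_num) (by norm_num) (hkmono.id_le n)
  have hmul : ∀ i j, ε * (1 / 2 : ℝ) ^ (F i).1 * (1 / 2) ^ (F j).1 ≤
      ε * (1 / 2) ^ i * (1 / 2) ^ j := by
    intro i j
    have := hpow i
    have := hpow j
    gcongr ε * ?_ * ?_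
  refine ⟨fun n => (F n).2.1, fun n => (F n).2.2, ?_, ?_, fun n => (hF n).2, ?_⟩
  · exact strictMono_nat_of_lt_succ fun n =>
      (hF n).1.trans (hr n (n + 1) n.lt_succ_self).2.1
  · exact strictMono_nat_of_lt_succ fun n =>
      (hr n (n + 1) n.lt_succ_self).2.1.trans (hF (n + 1)).1
  · intro i j hij
    rcases lt_or_gt_of_ne hij with h | h
    · exact (hr i j h).2.2.2.trans (hmul i j)
    · exact (hr j i h).2.2.1.trans (hmul i j)

end Selection

section Factorization

variable {X : Type*} [NormedAddCommGroup X] [NormedSpace ℝ X] [CompleteSpace X]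

theorem exists_factorization_of_small {e : ℕ → X} {f : ℕ → X →L[ℝ] ℝ}
    (hnorm : ∀ j, ‖e j‖ = 1)
    (hbi : ∀ j k, f j (e k) = if k = j then 1 else 0)
    (hexp : ∀ x : X, NormHasSum (fun j => f j x • e j) x)
    {Cu Cs : ℝ} (hu : NormUncond e Cu) (hs : NormSpreading e Cs)
    (T : X →L[ℝ] X) {δ ε : ℝ} (hdiag : ∀ j, δ ≤ |f j (T (e j))|) (hε : 0 < ε) (hεδ : ε < δ)
    (hκ : Cu * ((δ - ε)⁻¹ * ε * 2) * 2 < 1) :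
    ∃ A B : X →L[ℝ] X, A.comp (T.comp B) = ContinuousLinearMap.id ℝ X ∧
      ‖A‖ * ‖B‖ ≤
        1 / (1 - Cu * ((δ - ε)⁻¹ * ε * 2) * 2) * (Cs * (Cu * (δ - ε)⁻¹)) * (2 * Cs) := by
  have hCu : 0 ≤ Cu := zero_le_one.trans (hu.one_le hnorm)
  have hCs : 0 < Cs := zero_lt_one.trans_le (hs.one_le hnorm)
  have hM : 0 < (δ - ε)⁻¹ := inv_pos.2 (by linarith)
  obtain ⟨c, φ, hφ, hc⟩ := exists_subseq_tendsto_coord (f := f) (y := fun j => T (e j))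
    (C := ‖T‖) (fun j => by simpa [hnorm] using T.le_opNorm (e j))
  have hc0 := tendsto_limit_coord_zero hnorm hbi hexp hu hCu hs hCs T hφ hc
  obtain ⟨p, q, hp, hq, hpq, hoff⟩ := exists_almost_diagonal_pairs hnorm hexp T hφ hc hc0 hε
  set d : ℕ → ℝ := fun n => f (p n) (T (e (p n) - e (q n))) with hd
  have hdlow : ∀ n, δ - ε ≤ |d n| := by
    intro n
    have h1 := hdiag (p n)
    have h2 := hpq n
    have h3 := abs_sub_abs_le_abs_sub (f (p n) (T (e (p n)))) (f (p n) (T (e (q n))))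
    simp only [hd, map_sub]
    linarith
  have hγ : ∀ n, |(d n)⁻¹| ≤ (δ - ε)⁻¹ := fun n => by
    rw [abs_inv]
    exact inv_anti₀ (by linarith) (hdlow n)
  obtain ⟨J₁, hJ₁, hJ₁n⟩ := exists_spreading_clm hexp hu hCu hs hCs hp
  obtain ⟨J₂, hJ₂, hJ₂n⟩ := exists_spreading_clm hexp hu hCu hs hCs hq
  obtain ⟨R, hR, hRn⟩ := exists_compression_clm hbi hexp hu hCu hs hCs hp (fun n => (d n)⁻¹)
    hM.le hγ
  have hsingle : ∀ (v : ℕ → X) (j : ℕ) (y : X),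
      NormHasSum (fun i => f i (e j) • v i) y → y = v j := by
    intro v j y hy
    refine tendsto_nhds_unique hy ?_
    have := NormHasSum.of_support_subset (u := fun i => f i (e j) • v i) (s := {j})
      (by intro i hi; rw [Finset.mem_singleton] at hi; simp [hbi, Ne.symm hi])
    rw [Finset.sum_singleton, hbi, if_pos rfl, one_smul] at this
    exact this
  have hB : ∀ j, (J₁ - J₂) (e j) = e (p j) - e (q j) := fun j => by
    rw [sub_apply, hsingle _ j _ (hJ₁ (e j)), hsingle _ j _ (hJ₂ (e j))]
  have hBn : ‖J₁ - J₂‖ ≤ 2 * Cs :=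
    ContinuousLinearMap.opNorm_le_bound _ (by positivity) fun x => by
      calc ‖J₁ x - J₂ x‖ ≤ ‖J₁ x‖ + ‖J₂ x‖ := norm_sub_le _ _
        _ ≤ Cs * ‖x‖ + Cs * ‖x‖ := add_le_add (hJ₁n x) (hJ₂n x)
        _ = 2 * Cs * ‖x‖ := by ring
  have hcol : ∀ j, ‖(R.comp (T.comp (J₁ - J₂))) (e j) - e j‖ ≤
      (δ - ε)⁻¹ * ε * 2 * (1 / 2) ^ j := by
    intro j
    rw [ContinuousLinearMap.comp_apply, ContinuousLinearMap.comp_apply, hB]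
    refine (norm_sub_basis_vector_le hnorm (hR _) (j := j)
      (D := (δ - ε)⁻¹ * ε * (1 / 2) ^ j) ?_ (by positivity) ?_).trans (le_of_eq (by ring))
    · refine inv_mul_cancel₀ fun h0 => ?_
      have := hdlow j
      rw [show d j = 0 from h0, abs_zero] at this
      linarith
    · intro i hij
      rw [abs_mul]
      calc _ ≤ (δ - ε)⁻¹ * (ε * (1 / 2) ^ i * (1 / 2) ^ j) := by
            gcongr
            · exact hγ i
            · exact hoff i j hij
        _ = _ := by ring
  obtain ⟨V, hV, hVn⟩ := exists_left_inverse_of_near_id (R.comp (T.comp (J₁ - J₂)))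
    (by positivity) hκ (norm_sub_self_le_of_basis hexp hCu (by positivity)
      (hu.abs_coord_le hCu hnorm hexp) _ hcol)
  refine ⟨V.comp R, J₁ - J₂, hV, ?_⟩
  have hpos : 0 < 1 - Cu * ((δ - ε)⁻¹ * ε * 2) * 2 := by linarith
  gcongr
  refine (V.opNorm_comp_le R).trans ?_
  gcongr

end Factorization

/-- Every subsymmetric Schauder basis has the
`(2·Cu⁵·Cs³/δ)`-factorization property: if `T : X → X` is a bounded operator with
`δ`-large diagonal, then for every `η > 0` the identity `(2·Cu⁵·Cs³/δ + η)`-factors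
through `T`. -/
theorem subsymmetric_schauder_basis_factorization
    {X : Type*} [NormedAddCommGroup X] [NormedSpace ℝ X] [CompleteSpace X]
    (e : ℕ → X) (f : ℕ → X →L[ℝ] ℝ)
    (hnorm : ∀ j, ‖e j‖ = 1)
    (hbi : ∀ j k, f j (e k) = if k = j then 1 else 0)
    (hexp : ∀ x : X, NormHasSum (fun j => f j x • e j) x)
    (Cu Cs : ℝ)
    (hu : NormUncond e Cu) (hs : NormSpreading e Cs)
    (T : X →L[ℝ] X) (δ : ℝ) (hδ : 0 < δ)
    (hdiag : ∀ j, δ ≤ |f j (T (e j))|) :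
    ∀ η : ℝ, 0 < η →
      ∃ A B : X →L[ℝ] X,
        A.comp (T.comp B) = ContinuousLinearMap.id ℝ X ∧
        ‖A‖ * ‖B‖ ≤ 2 * Cu ^ 5 * Cs ^ 3 / δ + η := by
  intro η hη
  have hCu := hu.one_le hnorm
  have hCs := hs.one_le hnorm
  have hinv : Tendsto (fun ε : ℝ => (δ - ε)⁻¹) (𝓝 0) (𝓝 (δ - 0)⁻¹) :=
    (tendsto_const_nhds.sub tendsto_id).inv₀ (by simpa using hδ.ne')
  have hκ : Tendsto (fun ε : ℝ => Cu * ((δ - ε)⁻¹ * ε * 2) * 2) (𝓝 0)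
      (𝓝 (Cu * ((δ - 0)⁻¹ * 0 * 2) * 2)) :=
    (((hinv.mul tendsto_id).mul_const 2).const_mul Cu).mul_const 2
  have hbound : Tendsto (fun ε : ℝ => 1 / (1 - Cu * ((δ - ε)⁻¹ * ε * 2) * 2) *
      (Cs * (Cu * (δ - ε)⁻¹)) * (2 * Cs)) (𝓝 0)
      (𝓝 (1 / (1 - Cu * ((δ - 0)⁻¹ * 0 * 2) * 2) * (Cs * (Cu * (δ - 0)⁻¹)) * (2 * Cs))) :=
    (((tendsto_const_nhds.div (tendsto_const_nhds.sub hκ) (by simp)).mul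
      ((hinv.const_mul Cu).const_mul Cs))).mul_const _
  have hconst : 1 / (1 - Cu * ((δ - 0)⁻¹ * 0 * 2) * 2) * (Cs * (Cu * (δ - 0)⁻¹)) * (2 * Cs) <
      2 * Cu ^ 5 * Cs ^ 3 / δ + η := by
    have h1 : Cu ≤ Cu ^ 5 := le_self_pow₀ hCu (by norm_num)
    have h2 : Cs ^ 2 ≤ Cs ^ 3 := pow_le_pow_right₀ hCs (by norm_num)
    have h3 : 2 * Cu * Cs ^ 2 / δ ≤ 2 * Cu ^ 5 * Cs ^ 3 / δ := by gcongr
    refine lt_of_le_of_lt (le_of_eq ?_) (lt_add_of_le_of_pos h3 hη)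
    simp
    ring
  have hev := ((hκ.eventually_lt_const (by simp : _ < (1 : ℝ))).and
    ((hbound.eventually_lt_const hconst).and (eventually_lt_nhds hδ))).filter_mono
    (nhdsWithin_le_nhds (s := Set.Ioi 0))
  obtain ⟨ε, ⟨h1, h2, h3⟩, hε⟩ := (hev.and self_mem_nhdsWithin).exists
  obtain ⟨A, B, hAB, hn⟩ := exists_factorization_of_small hnorm hbi hexp hu hs T hdiag hε h3 h1
  exact ⟨A, B, hAB, hn.trans h2.le⟩
end

section
/- Let X and Y be Banach spaces and ⟨·,·⟩ : X × Y → ℝ a bilinear map with |⟨x,y⟩| ≤ C_d‖x‖_X‖y‖_Y for some constant C_d > 0. Let I ⊂ ℕ be an infinite set, n ∈ ℕ, L a positive even integer, η > 0, and let (x_j)_{j∈ℕ} ⊂ X and (y_j)_{j∈ℕ} ⊂ Y be bounded sequences. Then there exists an infinite set Λ ⊂ I such that for every B ⊂ Λ with |B| = L, every (ε_k) ∈ E(B) and every 1 ≤ j ≤ n one has |⟨Σ_{k∈B} ε_k x_k, y_j⟩| ≤ η and |⟨x_j, Σ_{k∈B} ε_k y_k⟩| ≤ η. -/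
open scoped Classical

/-- A sequence with bounded range in a proper space is nearly constant on some infinite subset
of any prescribed infinite set of indices. -/
theorem exists_infinite_subset_dist_le {E : Type*} [PseudoMetricSpace E] [ProperSpace E]
    {I : Set ℕ} (hI : I.Infinite) {f : ℕ → E} (hf : Bornology.IsBounded (Set.range f))
    {δ : ℝ} (hδ : 0 < δ) :
    ∃ Λ ⊆ I, Λ.Infinite ∧ ∃ a, ∀ k ∈ Λ, dist (f k) a ≤ δ := by
  let e := hI.natEmbedding
  obtain ⟨a, -, φ, hφ, ha⟩ :=
    tendsto_subseq_of_bounded hf (x := fun k => f (e k)) fun k => Set.mem_range_self _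
  obtain ⟨N, hN⟩ := Metric.tendsto_atTop.1 ha δ hδ
  have hinj : Function.Injective fun k => (e (φ k) : ℕ) :=
    Subtype.val_injective.comp (e.injective.comp hφ.injective)
  refine ⟨(fun k => (e (φ k) : ℕ)) '' Set.Ici N, ?_,
    (Set.Ici_infinite N).image hinj.injOn, a, ?_⟩
  · rintro _ ⟨k, -, rfl⟩
    exact (e (φ k)).2
  · rintro _ ⟨k, hk, rfl⟩
    exact (hN k hk).le

/-- A balanced signed sum of numbers close to a common value is small. -/
theorem abs_sum_balanced_signs_le {ι : Type*} [DecidableEq ι] {B S : Finset ι} (hS : S ⊆ B)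
    (hcard : 2 * S.card = B.card) {g : ι → ℝ} {c δ : ℝ} (hg : ∀ k ∈ B, |g k - c| ≤ δ) :
    |∑ k ∈ B, (if k ∈ S then (1 : ℝ) else -1) * g k| ≤ B.card * δ := by
  have hsigns : ∑ k ∈ B, (if k ∈ S then (1 : ℝ) else -1) = 0 := by
    have hsplit : ∀ k, (if k ∈ S then (1 : ℝ) else -1) = 2 * (if k ∈ S then 1 else 0) - 1 := by
      intro k
      split_ifs <;> norm_num
    have hB : (2 : ℝ) * S.card = B.card := by exact_mod_cast hcard
    simp only [hsplit, Finset.sum_sub_distrib, ← Finset.mul_sum, Finset.sum_ite_mem,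
      Finset.inter_eq_right.2 hS, Finset.sum_const, nsmul_eq_mul, mul_one, hB, sub_self]
  have hcentre : ∑ k ∈ B, (if k ∈ S then (1 : ℝ) else -1) * g k =
      ∑ k ∈ B, (if k ∈ S then (1 : ℝ) else -1) * (g k - c) := by
    simp only [mul_sub, Finset.sum_sub_distrib, ← Finset.sum_mul, hsigns, zero_mul, sub_zero]
  rw [hcentre, ← nsmul_eq_mul]
  refine (Finset.abs_sum_le_sum_abs _ _).trans (Finset.sum_le_card_nsmul _ _ _ fun k hk => ?_)
  have habs : |if k ∈ S then (1 : ℝ) else -1| = 1 := by split_ifs <;> simp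
  rw [abs_mul, habs, one_mul]
  exact hg k hk

/-- Subspace annihilation: given a bounded bilinear pairing
`β : X × Y → ℝ`, an infinite set `I ⊆ ℕ`, `n ∈ ℕ`, a positive even integer `L`,
`η > 0` and bounded sequences `(x j)` in `X` and `(y j)` in `Y`, there is an infinite
`Λ ⊆ I` such that for every `B ⊆ Λ` with `|B| = L`, every choice of signs
`(ε k) ∈ E(B)` (i.e. `ε k = ±1` on `B` with `∑_{k∈B} ε k = 0`, encoded here by the set
`S ⊆ B` of `k` with `ε k = 1`, `|S| = L/2`) and every `1 ≤ j ≤ n`, both pairings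
`|⟨∑_{k∈B} ε k x k, y j⟩|` and `|⟨x j, ∑_{k∈B} ε k y k⟩|` are at most `η`. -/
theorem annihilation_lemma
    {X Y : Type*} [NormedAddCommGroup X] [NormedSpace ℝ X] [CompleteSpace X]
    [NormedAddCommGroup Y] [NormedSpace ℝ Y] [CompleteSpace Y]
    (β : X →ₗ[ℝ] Y →ₗ[ℝ] ℝ) (Cd : ℝ) (hCd : 0 < Cd)
    (hβ : ∀ (x : X) (y : Y), |β x y| ≤ Cd * ‖x‖ * ‖y‖)
    (I : Set ℕ) (hI : I.Infinite)
    (n L : ℕ) (hL : 0 < L) (hLeven : Even L)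
    (η : ℝ) (hη : 0 < η)
    (x : ℕ → X) (y : ℕ → Y)
    (hx : ∃ C, ∀ j, ‖x j‖ ≤ C) (hy : ∃ C, ∀ j, ‖y j‖ ≤ C) :
    ∃ Λ : Set ℕ, Λ ⊆ I ∧ Λ.Infinite ∧
      ∀ B : Finset ℕ, ↑B ⊆ Λ → B.card = L →
        ∀ S ⊆ B, 2 * S.card = L →
          ∀ j, 1 ≤ j → j ≤ n →
            |β (∑ k ∈ B, (if k ∈ S then (1 : ℝ) else -1) • x k) (y j)| ≤ η ∧
            |β (x j) (∑ k ∈ B, (if k ∈ S then (1 : ℝ) else -1) • y k)| ≤ η := by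
  obtain ⟨C, hC⟩ := hx
  obtain ⟨D, hD⟩ := hy
  have hbound : ∀ i j, ‖β (x i) (y j)‖ ≤ Cd * C * D := fun i j => by
    have hC0 : 0 ≤ C := (norm_nonneg _).trans (hC i)
    refine (hβ _ _).trans ?_
    gcongr
    exacts [hC i, hD j]
  let f : ℕ → (Fin (n + 1) → ℝ) × (Fin (n + 1) → ℝ) :=
    fun k => (fun j => β (x k) (y j), fun j => β (x j) (y k))
  have hf : Bornology.IsBounded (Set.range f) := by
    refine isBounded_iff_forall_norm_le.2 ⟨Cd * C * D, ?_⟩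
    rintro _ ⟨k, rfl⟩
    have h0 := (norm_nonneg _).trans (hbound 0 0)
    exact norm_prod_le_iff.2 ⟨(pi_norm_le_iff_of_nonneg h0).2 fun j => hbound k j,
      (pi_norm_le_iff_of_nonneg h0).2 fun j => hbound j k⟩
  have hL' : (0 : ℝ) < L := by exact_mod_cast hL
  obtain ⟨Λ, hΛI, hΛ, a, ha⟩ := exists_infinite_subset_dist_le hI hf (div_pos hη hL')
  refine ⟨Λ, hΛI, hΛ, fun B hB hBL S hS hSL j _ hjn => ?_⟩
  have hj : j < n + 1 := Nat.lt_succ_of_le hjn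
  have hBη : (B.card : ℝ) * (η / L) = η := by rw [hBL, mul_div_cancel₀ _ hL'.ne']
  have hcard : 2 * S.card = B.card := hSL.trans hBL.symm
  constructor
  · have h := abs_sum_balanced_signs_le hS hcard (g := fun k => β (x k) (y j)) (c := a.1 ⟨j, hj⟩)
      fun k hk => (dist_le_pi_dist (f k).1 a.1 ⟨j, hj⟩).trans
        ((le_max_left _ _).trans (ha k (hB hk)))
    simpa [hBη, -ite_smul, -ite_mul] using h
  · have h := abs_sum_balanced_signs_le hS hcard (g := fun k => β (x j) (y k)) (c := a.2 ⟨j, hj⟩)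
      fun k hk => (dist_le_pi_dist (f k).2 a.2 ⟨j, hj⟩).trans
        ((le_max_right _ _).trans (ha k (hB hk)))
    simpa [hBη, -ite_smul, -ite_mul] using h
end

section
/- Assume the dual-pair setup (B1)–(B5) with (e_j) C_u-unconditional and non-ℓ¹-splicing. Let I ⊂ ℕ be an infinite set, η > 0, let y_1, …, y_n ∈ Y, and let T : X → X be a bounded linear operator. Then there exists an infinite set Λ ⊂ I such that sup_{‖x‖_X ≤ 1} |⟨T P_Λ x, y_j⟩| ≤ η for all 1 ≤ j ≤ n. -/
open scoped Classical
open Filter Topology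

/-- The series `∑ u j` converges to `x` in the `σ(X,Y)`-topology induced by the
bilinear map `β` (convergence of the pairing of the partial sums against every `y ∈ Y`). -/
def SigmaHasSum {X Y : Type*} [NormedAddCommGroup X] [NormedSpace ℝ X]
    [NormedAddCommGroup Y] [NormedSpace ℝ Y]
    (β : X →ₗ[ℝ] Y →ₗ[ℝ] ℝ) (u : ℕ → X) (x : X) : Prop :=
  ∀ y : Y, Tendsto (fun n => β (∑ j ∈ Finset.range n, u j) y) atTop (𝓝 (β x y))

/-- Axioms (B1)–(B5) for the dual pair `(X, Y, β)` together with the normalized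
sequences `(e j) ⊆ X` and `(f j) ⊆ Y`:
(B1) `β` separates points of `X`; (B2) `β` separates points of `Y`;
(B3) `|β x y| ≤ Cd‖x‖‖y‖`; (B4) `(e j)` and `(f j)` are biorthogonal;
(B5) every `x` has the (unique) representation `x = ∑ β x (f j) • e j`,
the series converging in the `σ(X,Y)`-topology. -/
def DualPair {X Y : Type*} [NormedAddCommGroup X] [NormedSpace ℝ X]
    [NormedAddCommGroup Y] [NormedSpace ℝ Y]
    (β : X →ₗ[ℝ] Y →ₗ[ℝ] ℝ) (Cd : ℝ) (e : ℕ → X) (f : ℕ → Y) : Prop :=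
  (∀ x : X, (∀ y : Y, β x y = 0) → x = 0) ∧
  (∀ y : Y, (∀ x : X, β x y = 0) → y = 0) ∧
  (0 < Cd ∧ ∀ (x : X) (y : Y), |β x y| ≤ Cd * ‖x‖ * ‖y‖) ∧
  (∀ j, ‖e j‖ = 1) ∧ (∀ j, ‖f j‖ = 1) ∧
  (∀ j k, β (e j) (f k) = if j = k then 1 else 0) ∧
  (∀ x : X, SigmaHasSum β (fun j => β x (f j) • e j) x) ∧
  (∀ (x : X) (a : ℕ → ℝ), SigmaHasSum β (fun j => a j • e j) x → ∀ j, a j = β x (f j))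

/-- `(e j)` is `Cu`-unconditional (series converging in the `σ(X,Y)`-topology). -/
def SigmaUncond {X Y : Type*} [NormedAddCommGroup X] [NormedSpace ℝ X]
    [NormedAddCommGroup Y] [NormedSpace ℝ Y]
    (β : X →ₗ[ℝ] Y →ₗ[ℝ] ℝ) (e : ℕ → X) (Cu : ℝ) : Prop :=
  ∀ (a γ : ℕ → ℝ) (x x' : X), BddAbove (Set.range fun k => |γ k|) →
    SigmaHasSum β (fun j => a j • e j) x →
    SigmaHasSum β (fun j => (γ j * a j) • e j) x' →
    ‖x'‖ ≤ Cu * (⨆ k, |γ k|) * ‖x‖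

/-- `(e j)` is `Cs`-spreading (series converging in the `σ(X,Y)`-topology). -/
def SigmaSpreading {X Y : Type*} [NormedAddCommGroup X] [NormedSpace ℝ X]
    [NormedAddCommGroup Y] [NormedSpace ℝ Y]
    (β : X →ₗ[ℝ] Y →ₗ[ℝ] ℝ) (e : ℕ → X) (Cs : ℝ) : Prop :=
  ∀ (a : ℕ → ℝ) (m : ℕ → ℕ), StrictMono m → ∀ (x x' : X),
    SigmaHasSum β (fun j => a j • e j) x →
    SigmaHasSum β (fun j => a j • e (m j)) x' →
    (1 / Cs) * ‖x'‖ ≤ ‖x‖ ∧ ‖x‖ ≤ Cs * ‖x'‖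

/-- `(e j)` is non-`ℓ¹`-splicing, where `P Λ` denotes the basis projection onto the
coordinates in `Λ`: for every infinite `I ⊆ ℕ` and every `θ > 0` there are pairwise
disjoint infinite subsets `Λ j ⊆ I` such that for every sequence `(x j)` in the unit
ball of `X` there are scalars `(a j)` with `∑ |a j| = 1` and `‖∑ a j • P (Λ j) (x j)‖ ≤ θ`. -/
def NonL1Splicing {X : Type*} [NormedAddCommGroup X] [NormedSpace ℝ X]
    (P : Set ℕ → X →L[ℝ] X) : Prop :=
  ∀ I : Set ℕ, I.Infinite → ∀ θ : ℝ, 0 < θ →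
    ∃ Λ : ℕ → Set ℕ,
      (∀ j, (Λ j).Infinite) ∧ (∀ j, Λ j ⊆ I) ∧
      (∀ j k, j ≠ k → Disjoint (Λ j) (Λ k)) ∧
      ∀ x : ℕ → X, (∀ j, ‖x j‖ ≤ 1) →
        ∃ (a : ℕ → ℝ) (z : X),
          HasSum (fun j => |a j|) 1 ∧
          HasSum (fun j => a j • P (Λ j) (x j)) z ∧ ‖z‖ ≤ θ

section DualPairLemmas

variable {X Y : Type*} [NormedAddCommGroup X] [NormedSpace ℝ X]
  [NormedAddCommGroup Y] [NormedSpace ℝ Y]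
  {β : X →ₗ[ℝ] Y →ₗ[ℝ] ℝ} {Cd : ℝ} {e : ℕ → X} {f : ℕ → Y}

/-- Pairing with a fixed `y` is a continuous functional on `X`. -/
theorem DualPair.exists_pairing_clm (hdp : DualPair β Cd e f) (y : Y) :
    ∃ φ : X →L[ℝ] ℝ, ∀ x, φ x = β x y := by
  obtain ⟨-, -, ⟨-, hb⟩, -⟩ := hdp
  refine ⟨(β.flip y).mkContinuous (Cd * ‖y‖) fun x => ?_, fun x => rfl⟩
  have := hb x y
  rw [LinearMap.flip_apply, Real.norm_eq_abs]
  linarith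

/-- A vector is determined by its coordinates. -/
theorem DualPair.ext_coord (hdp : DualPair β Cd e f) {x x' : X}
    (h : ∀ k, β x (f k) = β x' (f k)) : x = x' := by
  obtain ⟨hsep, -, -, -, -, -, hexp, -⟩ := hdp
  rw [← sub_eq_zero]
  refine hsep _ fun y => ?_
  have hx := hexp x y
  simp only [h] at hx
  rw [map_sub, LinearMap.sub_apply, tendsto_nhds_unique hx (hexp x' y), sub_self]

/-- Multiplying coordinates by a bounded multiplier `|γ| ≤ 1` costs at most a factor `|Cu|`. -/
theorem DualPair.norm_le_of_coord_eq_mul (hdp : DualPair β Cd e f) {Cu : ℝ}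
    (hue : SigmaUncond β e Cu) {x x' : X} (γ : ℕ → ℝ) (hγ : ∀ k, |γ k| ≤ 1)
    (h : ∀ k, β x' (f k) = γ k * β x (f k)) : ‖x'‖ ≤ |Cu| * ‖x‖ := by
  obtain ⟨-, -, -, -, -, -, hexp, -⟩ := hdp
  have hx' := hexp x'
  simp only [h] at hx'
  have hbdd : BddAbove (Set.range fun k => |γ k|) := ⟨1, by rintro _ ⟨k, rfl⟩; exact hγ k⟩
  have hsup : (⨆ k, |γ k|) ≤ 1 := ciSup_le hγ
  have hsup0 : 0 ≤ ⨆ k, |γ k| := Real.iSup_nonneg fun k => abs_nonneg _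
  refine (hue _ γ x x' hbdd (hexp x) hx').trans ?_
  refine mul_le_mul_of_nonneg_right ?_ (norm_nonneg x)
  calc Cu * (⨆ k, |γ k|) ≤ |Cu| * (⨆ k, |γ k|) := by gcongr; exact le_abs_self Cu
    _ ≤ |Cu| * 1 := by gcongr
    _ = |Cu| := mul_one _

variable {P : Set ℕ → X →L[ℝ] X}

theorem DualPair.norm_proj_le (hdp : DualPair β Cd e f) {Cu : ℝ} (hue : SigmaUncond β e Cu)
    (hP : ∀ (Λ : Set ℕ) (x : X) (j : ℕ),
      β (P Λ x) (f j) = if j ∈ Λ then β x (f j) else 0)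
    (Λ : Set ℕ) (x : X) : ‖P Λ x‖ ≤ |Cu| * ‖x‖ := by
  refine hdp.norm_le_of_coord_eq_mul hue (fun k => if k ∈ Λ then 1 else 0)
    (fun k => ?_) fun k => ?_
  · split_ifs <;> simp
  · rw [hP, ite_mul, one_mul, zero_mul]

theorem DualPair.proj_proj (hdp : DualPair β Cd e f)
    (hP : ∀ (Λ : Set ℕ) (x : X) (j : ℕ),
      β (P Λ x) (f j) = if j ∈ Λ then β x (f j) else 0)
    {Λ Λ' : Set ℕ} (h : Λ' ⊆ Λ) (x : X) : P Λ (P Λ' x) = P Λ' x := by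
  refine hdp.ext_coord fun k => ?_
  simp only [hP]
  by_cases hk : k ∈ Λ'
  · simp [hk, h hk]
  · simp [hk]

/-- By unconditionality, the scalars of a disjoint splice may be replaced by their absolute
values. -/
theorem DualPair.exists_hasSum_abs [CompleteSpace X] (hdp : DualPair β Cd e f) {Cu : ℝ}
    (hue : SigmaUncond β e Cu)
    (hP : ∀ (Λ : Set ℕ) (x : X) (j : ℕ),
      β (P Λ x) (f j) = if j ∈ Λ then β x (f j) else 0)
    {Λ : ℕ → Set ℕ} (hdisj : ∀ j k, j ≠ k → Disjoint (Λ j) (Λ k))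
    {x : ℕ → X} (hx : ∀ j, ‖x j‖ ≤ 1) {a : ℕ → ℝ} (ha : Summable fun j => |a j|)
    {z : X} (hz : HasSum (fun j => a j • P (Λ j) (x j)) z) :
    ∃ w : X, HasSum (fun j => |a j| • P (Λ j) (x j)) w ∧ ‖w‖ ≤ |Cu| * ‖z‖ := by
  have hsum : Summable fun j => |a j| • P (Λ j) (x j) := by
    refine Summable.of_norm_bounded (ha.mul_right |Cu|) fun j => ?_
    rw [norm_smul, Real.norm_eq_abs, abs_abs]
    gcongr
    calc ‖P (Λ j) (x j)‖ ≤ |Cu| * ‖x j‖ := hdp.norm_proj_le hue hP _ _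
      _ ≤ |Cu| * 1 := by gcongr; exact hx j
      _ = |Cu| := mul_one _
  obtain ⟨w, hw⟩ := hsum
  refine ⟨w, hw, hdp.norm_le_of_coord_eq_mul hue
    (fun k => if ∃ j, k ∈ Λ j ∧ a j < 0 then -1 else 1) (fun k => ?_) fun k => ?_⟩
  · split_ifs <;> simp
  · obtain ⟨φ, hφ⟩ := hdp.exists_pairing_clm (f k)
    have h1 := φ.hasSum hw
    have h2 := (φ.hasSum hz).mul_left (if ∃ j, k ∈ Λ j ∧ a j < 0 then (-1 : ℝ) else 1)
    rw [← hφ, ← hφ]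
    refine h1.unique ?_
    refine (congrArg (HasSum · _) (funext fun j => ?_)).mpr h2
    rw [map_smul, map_smul, smul_eq_mul, smul_eq_mul, hφ, hP]
    by_cases hk : k ∈ Λ j
    · have hiff : (∃ i, k ∈ Λ i ∧ a i < 0) ↔ a j < 0 := by
        refine ⟨?_, fun h => ⟨j, hk, h⟩⟩
        rintro ⟨i, hi, hai⟩
        by_cases hij : i = j
        · exact hij ▸ hai
        · exact absurd hk (Set.disjoint_left.mp (hdisj i j hij) hi)
      by_cases haj : a j < 0
      · simp [hiff, haj, abs_of_neg haj]
      · simp [hiff, haj, abs_of_nonneg (not_lt.mp haj)]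
    · simp [hk]

/-- A single continuous functional is small on the range of some basis projection. -/
theorem NonL1Splicing.exists_abs_le [CompleteSpace X] (hsplice : NonL1Splicing P)
    (hdp : DualPair β Cd e f) {Cu : ℝ} (hue : SigmaUncond β e Cu)
    (hP : ∀ (Λ : Set ℕ) (x : X) (j : ℕ),
      β (P Λ x) (f j) = if j ∈ Λ then β x (f j) else 0)
    {I : Set ℕ} (hI : I.Infinite) {η : ℝ} (hη : 0 < η) (φ : X →L[ℝ] ℝ) :
    ∃ Λ : Set ℕ, Λ ⊆ I ∧ Λ.Infinite ∧ ∀ x : X, ‖x‖ ≤ 1 → |φ (P Λ x)| ≤ η := by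
  have hK : 0 < ‖φ‖ * |Cu| + 1 := by positivity
  obtain ⟨Λ, hinf, hsub, hdisj, hΛ⟩ := hsplice I hI (η / (‖φ‖ * |Cu| + 1)) (by positivity)
  by_contra! hcon
  have hbad : ∀ j, ∃ x : X, ‖x‖ ≤ 1 ∧ η ≤ φ (P (Λ j) x) := by
    intro j
    obtain ⟨x, hx, hlt⟩ := hcon (Λ j) (hsub j) (hinf j)
    rcases lt_abs.mp hlt with h | h
    · exact ⟨x, hx, h.le⟩
    · exact ⟨-x, by rwa [norm_neg], by rw [map_neg, map_neg]; exact h.le⟩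
  choose x hx hφx using hbad
  obtain ⟨a, z, ha, hz, hzθ⟩ := hΛ x hx
  obtain ⟨w, hw, hwz⟩ := hdp.exists_hasSum_abs hue hP hdisj hx ha.summable hz
  have hlow : 1 * η ≤ φ w := by
    refine hasSum_le (fun j => ?_) (ha.mul_right η) (φ.hasSum hw)
    rw [map_smul, smul_eq_mul]
    exact mul_le_mul_of_nonneg_left (hφx j) (abs_nonneg _)
  have hup : φ w ≤ ‖φ‖ * |Cu| * (η / (‖φ‖ * |Cu| + 1)) :=
    calc φ w ≤ ‖φ w‖ := Real.le_norm_self _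
      _ ≤ ‖φ‖ * ‖w‖ := φ.le_opNorm w
      _ ≤ ‖φ‖ * (|Cu| * (η / (‖φ‖ * |Cu| + 1))) := by
        gcongr
        exact hwz.trans (by gcongr)
      _ = _ := by ring
  have hlt : ‖φ‖ * |Cu| * (η / (‖φ‖ * |Cu| + 1)) < η := by
    rw [← mul_div_assoc, div_lt_iff₀ hK]
    nlinarith
  linarith

/-- Finitely many continuous functionals are simultaneously small on the range of some basis
projection. -/
theorem NonL1Splicing.exists_forall_abs_le [CompleteSpace X] (hsplice : NonL1Splicing P)
    (hdp : DualPair β Cd e f) {Cu : ℝ} (hue : SigmaUncond β e Cu)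
    (hP : ∀ (Λ : Set ℕ) (x : X) (j : ℕ),
      β (P Λ x) (f j) = if j ∈ Λ then β x (f j) else 0)
    {I : Set ℕ} (hI : I.Infinite) {η : ℝ} (hη : 0 < η) (φ : ℕ → X →L[ℝ] ℝ) (n : ℕ) :
    ∃ Λ : Set ℕ, Λ ⊆ I ∧ Λ.Infinite ∧
      ∀ Λ' ⊆ Λ, ∀ x : X, ‖x‖ ≤ 1 → ∀ j < n, |φ j (P Λ' x)| ≤ η := by
  induction n with
  | zero => exact ⟨I, subset_rfl, hI, by simp⟩
  | succ n ih =>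
    obtain ⟨Λ, hΛI, hΛ, h⟩ := ih
    have hK : 0 < |Cu| + 1 := by positivity
    obtain ⟨M, hMΛ, hM, hφ⟩ :=
      hsplice.exists_abs_le hdp hue hP hΛ (div_pos hη hK) (φ n)
    refine ⟨M, hMΛ.trans hΛI, hM, fun Λ' hΛ' x hx j hj => ?_⟩
    rcases Nat.lt_succ_iff_lt_or_eq.mp hj with hj | rfl
    · exact h Λ' (hΛ'.trans hMΛ) x hx j hj
    · have hnorm : ‖P Λ' x‖ ≤ |Cu| + 1 := by
        have h1 := hdp.norm_proj_le hue hP Λ' x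
        nlinarith [abs_nonneg Cu]
      have hscaled := hφ ((|Cu| + 1)⁻¹ • P Λ' x) (by
        rw [norm_smul, norm_inv, Real.norm_of_nonneg hK.le, inv_mul_le_iff₀ hK]
        simpa using hnorm)
      rw [map_smul, map_smul, hdp.proj_proj hP hΛ', smul_eq_mul, abs_mul, abs_inv,
        abs_of_pos hK, inv_mul_le_iff₀ hK, mul_div_cancel₀ _ hK.ne'] at hscaled
      exact hscaled

end DualPairLemmas

/-- Under (B1)–(B5) with `(e j)` `Cu`-unconditional and
non-`ℓ¹`-splicing: for every infinite `I ⊆ ℕ`, every `η > 0`, all `y 1, …, y n ∈ Y` and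
every bounded operator `T : X → X` there is an infinite `Λ ⊆ I` such that
`sup_{‖x‖ ≤ 1} |⟨T P_Λ x, y j⟩| ≤ η` for all `1 ≤ j ≤ n`. -/
theorem splicing_annihilation
    {X Y : Type*} [NormedAddCommGroup X] [NormedSpace ℝ X] [CompleteSpace X]
    [NormedAddCommGroup Y] [NormedSpace ℝ Y] [CompleteSpace Y]
    (β : X →ₗ[ℝ] Y →ₗ[ℝ] ℝ) (Cd : ℝ) (e : ℕ → X) (f : ℕ → Y)
    (hdp : DualPair β Cd e f)
    (Cu : ℝ) (hue : SigmaUncond β e Cu)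
    (P : Set ℕ → X →L[ℝ] X)
    (hP : ∀ (Λ : Set ℕ) (x : X) (j : ℕ),
      β (P Λ x) (f j) = if j ∈ Λ then β x (f j) else 0)
    (hsplice : NonL1Splicing P)
    (I : Set ℕ) (hI : I.Infinite)
    (η : ℝ) (hη : 0 < η)
    (n : ℕ) (y : ℕ → Y)
    (T : X →L[ℝ] X) :
    ∃ Λ : Set ℕ, Λ ⊆ I ∧ Λ.Infinite ∧
      ∀ x : X, ‖x‖ ≤ 1 → ∀ j, 1 ≤ j → j ≤ n → |β (T (P Λ x)) (y j)| ≤ η := by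
  choose φ hφ using fun j => hdp.exists_pairing_clm (y j)
  obtain ⟨Λ, hΛI, hΛ, h⟩ :=
    hsplice.exists_forall_abs_le hdp hue hP hI hη (fun j => (φ j).comp T) (n + 1)
  refine ⟨Λ, hΛI, hΛ, fun x hx j _ hj => ?_⟩
  rw [← hφ]
  exact h Λ subset_rfl x hx j (Nat.lt_succ_of_le hj)
end

section
/- Let (e_j)_{j∈ℕ} be a normalized basis of a Banach space X with biorthogonal functionals (e_j*), and assume both (e_j) and (e_j*) are C_s-spreading. Then for every integer n ≥ 2, ν(n) ≤ C_s·min(λ(n−1), μ(n−1)), where λ(m) = ‖Σ_{j=1}^m e_j‖_X and μ(m) = ‖Σ_{j=1}^m e_j*‖_{X*}. -/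
open Filter Topology

/-- `(e j)` is `Cu`-unconditional:
`‖∑_{j∈F} γ_j a_j e_j‖ ≤ Cu · max_{j∈F}|γ_j| · ‖∑_{j∈F} a_j e_j‖` for every finite `F`. -/
def FinsetUncond {X ι : Type*} [NormedAddCommGroup X] [NormedSpace ℝ X]
    (e : ι → X) (Cu : ℝ) : Prop :=
  ∀ (F : Finset ι) (a γ : ι → ℝ),
    ‖∑ j ∈ F, (γ j * a j) • e j‖ ≤ Cu * (⨆ j ∈ F, |γ j|) * ‖∑ j ∈ F, a j • e j‖

/-- `(e j)` is `Cs`-spreading: for every `m`, all scalars and all strictly increasing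
indices `n_1 < … < n_m`,
`(1/Cs)·‖∑_{j<m} a_j e_{n_j}‖ ≤ ‖∑_{j<m} a_j e_j‖ ≤ Cs·‖∑_{j<m} a_j e_{n_j}‖`. -/
def SeqSpreading {X : Type*} [NormedAddCommGroup X] [NormedSpace ℝ X]
    (e : ℕ → X) (Cs : ℝ) : Prop :=
  ∀ (m : ℕ) (a : ℕ → ℝ) (ns : ℕ → ℕ), StrictMono ns →
    (1 / Cs) * ‖∑ j ∈ Finset.range m, a j • e (ns j)‖ ≤
        ‖∑ j ∈ Finset.range m, a j • e j‖ ∧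
    ‖∑ j ∈ Finset.range m, a j • e j‖ ≤ Cs * ‖∑ j ∈ Finset.range m, a j • e (ns j)‖

/-- `τ(n)`: the maximum over all signs `ε i j ∈ {±1}` of
`min( max_{j<n} ‖∑_{i<n, i≠j} ε i j • e i‖ , max_{i<n} ‖∑_{j<n, j≠i} ε i j • f j‖ )`. -/
noncomputable def tauN {X : Type*} [NormedAddCommGroup X] [NormedSpace ℝ X]
    (e : ℕ → X) (f : ℕ → X →L[ℝ] ℝ) (n : ℕ) : ℝ :=
  ⨆ ε : ℕ → ℕ → Bool,
    min (⨆ j ∈ Finset.range n,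
          ‖∑ i ∈ (Finset.range n).erase j, (if ε i j then (1 : ℝ) else -1) • e i‖)
        (⨆ i ∈ Finset.range n,
          ‖∑ j ∈ (Finset.range n).erase i, (if ε i j then (1 : ℝ) else -1) • f j‖)

/-- `ν(n)`: the supremum over all `A ⊆ ℕ` with `|A| = n` of
`min( max_{l∈A} ‖∑_{k∈A∖{l}} e k‖ , max_{k∈A} ‖∑_{l∈A∖{k}} f l‖ )`. -/
noncomputable def nuN {X : Type*} [NormedAddCommGroup X] [NormedSpace ℝ X]
    (e : ℕ → X) (f : ℕ → X →L[ℝ] ℝ) (n : ℕ) : ℝ :=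
  sSup { r : ℝ | ∃ A : Finset ℕ, A.card = n ∧
    r = min (⨆ l ∈ A, ‖∑ k ∈ A.erase l, e k‖) (⨆ k ∈ A, ‖∑ l ∈ A.erase k, f l‖) }

/-- A finite set of `m` naturals is the image of `range m` under a strictly increasing sequence. -/
theorem exists_strictMono_sum_range_eq {M : Type*} [AddCommMonoid M] (B : Finset ℕ) :
    ∃ ns : ℕ → ℕ, StrictMono ns ∧
      ∀ g : ℕ → M, ∑ j ∈ Finset.range B.card, g (ns j) = ∑ k ∈ B, g k := by
  refine ⟨fun j => if h : j < B.card then B.orderEmbOfFin rfl ⟨j, h⟩ else B.sup id + j + 1,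
    fun i j hij => ?_, fun g => ?_⟩
  · by_cases hj : j < B.card
    · have hi : i < B.card := hij.trans hj
      simpa [hi, hj] using hij
    · by_cases hi : i < B.card
      · have h : B.orderEmbOfFin rfl ⟨i, hi⟩ ≤ B.sup id :=
          Finset.le_sup (f := id) (B.orderEmbOfFin_mem rfl ⟨i, hi⟩)
        simp only [hi, hj, dite_true, dite_false]
        omega
      · simp only [hi, hj, dite_false]
        omega
  · rw [Finset.sum_range]
    simp only [Fin.is_lt, dite_true]
    conv_rhs => rw [← B.map_orderEmbOfFin_univ rfl, Finset.sum_map]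
    rfl

/-- The constant of a spreading sequence of norm-one vectors is positive. -/
theorem SeqSpreading.pos {X : Type*} [NormedAddCommGroup X] [NormedSpace ℝ X]
    {e : ℕ → X} {Cs : ℝ} (hs : SeqSpreading e Cs) (he : ‖e 0‖ = 1) : 0 < Cs := by
  have h := (hs 1 1 id strictMono_id).2
  simp [he] at h
  linarith

/-- Sums of a spreading sequence over a finite set are controlled by initial sums. -/
theorem SeqSpreading.norm_sum_le {X : Type*} [NormedAddCommGroup X] [NormedSpace ℝ X]
    {e : ℕ → X} {Cs : ℝ} (hs : SeqSpreading e Cs) (hC : 0 < Cs) (B : Finset ℕ) :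
    ‖∑ k ∈ B, e k‖ ≤ Cs * ‖∑ j ∈ Finset.range B.card, e j‖ := by
  obtain ⟨ns, hns, hsum⟩ := exists_strictMono_sum_range_eq (M := X) B
  have h := (hs B.card 1 ns hns).1
  simp only [Pi.one_apply, one_smul] at h
  rwa [hsum e, one_div, inv_mul_le_iff₀ hC] at h

/-- The largest norm of a sum over `A` with one index removed, for a spreading sequence. -/
theorem SeqSpreading.iSup_norm_sum_erase_le {X : Type*} [NormedAddCommGroup X]
    [NormedSpace ℝ X] {e : ℕ → X} {Cs : ℝ} (hs : SeqSpreading e Cs) (hC : 0 < Cs)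
    (A : Finset ℕ) :
    ⨆ l ∈ A, ‖∑ k ∈ A.erase l, e k‖ ≤ Cs * ‖∑ j ∈ Finset.range (A.card - 1), e j‖ := by
  have h0 : 0 ≤ Cs * ‖∑ j ∈ Finset.range (A.card - 1), e j‖ := by positivity
  refine Real.iSup_le (fun l => Real.iSup_le (fun hl => ?_) h0) h0
  simpa only [Finset.card_erase_of_mem hl] using hs.norm_sum_le hC (A.erase l)

/-- If `(e j)` is a normalized basis of a Banach space `X` with
biorthogonal functionals `(e j)*`, and both `(e j)` and `(e j)*` are `Cs`-spreading,
then for every `n ≥ 2`, `ν(n) ≤ Cs · min(λ(n−1), μ(n−1))` where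
`λ(m) = ‖∑_{j=1}^m e_j‖` and `μ(m) = ‖∑_{j=1}^m e_j*‖`. -/
theorem nu_le_of_spreading
    {X : Type*} [NormedAddCommGroup X] [NormedSpace ℝ X] [CompleteSpace X]
    (e : ℕ → X) (f : ℕ → X →L[ℝ] ℝ)
    (hnorm : ∀ j, ‖e j‖ = 1)
    (hbi : ∀ j k, f j (e k) = if k = j then 1 else 0)
    (hexp : ∀ x : X, NormHasSum (fun j => f j x • e j) x)
    (Cs : ℝ) (hse : SeqSpreading e Cs) (hsf : SeqSpreading f Cs) :
    ∀ n : ℕ, 2 ≤ n →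
      nuN e f n ≤ Cs * min ‖∑ j ∈ Finset.range (n - 1), e j‖
        ‖∑ j ∈ Finset.range (n - 1), f j‖ := by
  intro n _
  have hC : 0 < Cs := hse.pos (hnorm 0)
  refine Real.sSup_le ?_ (by positivity)
  rintro r ⟨A, rfl, rfl⟩
  rw [mul_min_of_nonneg _ _ hC.le]
  exact min_le_min (hse.iSup_norm_sum_erase_le hC A) (hsf.iSup_norm_sum_erase_le hC A)
end

section
/- Let (e_j)_{j∈ℕ} be a normalized basis of a Banach space X with biorthogonal functionals (e_j*), and assume both (e_j) and (e_j*) are (C_u,C_s)-subsymmetric. Then for every integer n ≥ 2, τ(n) ≤ √(2·C_u³·C_s³·(n−1)). -/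
open Filter Topology

open Finset in
/-- A square double sum splits along its diagonals: those on or above the main one, and those
strictly below it. -/
theorem sum_range_sum_range_eq_sum_diagonals {M : Type*} [AddCommMonoid M] (g : ℕ → ℕ → M)
    (m : ℕ) :
    ∑ i ∈ range m, ∑ j ∈ range m, g i j =
      ∑ d ∈ range m, ∑ i ∈ range (m - d), g i (i + d) +
        ∑ d ∈ range m, ∑ i ∈ range (m - (d + 1)), g (i + (d + 1)) i := by
  induction m with
  | zero => simp
  | succ m ih =>
    have upper : ∑ d ∈ range (m + 1), ∑ i ∈ range (m + 1 - d), g i (i + d) =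
        ∑ d ∈ range m, ∑ i ∈ range (m - d), g i (i + d) + ∑ i ∈ range (m + 1), g i m := by
      have step : ∀ d ∈ range (m + 1), ∑ i ∈ range (m + 1 - d), g i (i + d) =
          ∑ i ∈ range (m - d), g i (i + d) + g (m + 1 - 1 - d) m := by
        intro d hd
        have hd : d ≤ m := Nat.lt_succ_iff.mp (mem_range.mp hd)
        rw [Nat.succ_sub hd, sum_range_succ, Nat.sub_add_cancel hd, Nat.add_sub_cancel]
      rw [sum_congr rfl step, sum_add_distrib, sum_range_reflect (fun i => g i m)]
      simp [sum_range_succ]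
    have lower : ∑ d ∈ range (m + 1), ∑ i ∈ range (m + 1 - (d + 1)), g (i + (d + 1)) i =
        ∑ d ∈ range m, ∑ i ∈ range (m - (d + 1)), g (i + (d + 1)) i +
          ∑ j ∈ range m, g m j := by
      have step : ∀ d ∈ range m, ∑ i ∈ range (m + 1 - (d + 1)), g (i + (d + 1)) i =
          ∑ i ∈ range (m - (d + 1)), g (i + (d + 1)) i + g m (m - 1 - d) := by
        intro d hd
        have hd : d + 1 ≤ m := mem_range.mp hd
        rw [Nat.succ_sub hd, sum_range_succ, Nat.sub_add_cancel hd, Nat.sub_sub, Nat.add_comm 1 d]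
      rw [sum_range_succ, sum_congr rfl step, sum_add_distrib, sum_range_reflect (fun i => g m i)]
      simp
    rw [upper, lower, sum_range_succ _ m, sum_range_succ (fun i => g i m) m]
    simp only [sum_range_succ (fun j => g _ j) m, sum_add_distrib, ih]
    abel

open Finset in
theorem sum_range_succ_erase {M : Type*} [AddCommMonoid M] (u : ℕ → M) {m j : ℕ}
    (hj : j ∈ range (m + 1)) :
    ∑ i ∈ (range (m + 1)).erase j, u i = ∑ i ∈ range m, u (if i < j then i else i + 1) := by
  rw [mem_range] at hj
  refine sum_nbij' (fun i => if i < j then i else i - 1) (fun i => if i < j then i else i + 1)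
    ?_ ?_ ?_ ?_ ?_
  · intro i hi; simp only [mem_erase, mem_range] at *; split_ifs <;> omega
  · intro i hi; simp only [mem_erase, mem_range] at *; split_ifs <;> omega
  · intro i hi; simp only [mem_erase, mem_range] at *; split_ifs <;> omega
  · intro i hi; simp only [mem_range] at *; split_ifs <;> omega
  · intro i hi
    congr 1
    simp only [mem_erase, mem_range] at *; split_ifs <;> omega

section NormedSpace

variable {X ι : Type*} [NormedAddCommGroup X] [NormedSpace ℝ X]

theorem FinsetUncond.one_le {e : ι → X} {Cu : ℝ} (h : FinsetUncond e Cu) {i : ι}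
    (hi : ‖e i‖ = 1) : 1 ≤ Cu := by
  have key := h {i} 1 1
  have hsup : (⨆ j ∈ ({i} : Finset ι), |(1 : ι → ℝ) j|) ≤ 1 :=
    Real.iSup_le (fun j => Real.iSup_le (fun _ => by simp) zero_le_one) zero_le_one
  have hsup_nonneg : 0 ≤ ⨆ j ∈ ({i} : Finset ι), |(1 : ι → ℝ) j| :=
    Real.iSup_nonneg fun j => Real.iSup_nonneg fun _ => abs_nonneg _
  generalize (⨆ j ∈ ({i} : Finset ι), |(1 : ι → ℝ) j|) = s at *
  simp only [Finset.sum_singleton, Pi.one_apply, one_smul, mul_one, hi] at key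
  rcases le_total 0 Cu with hCu | hCu <;> nlinarith

theorem FinsetUncond.norm_sum_le {e : ι → X} {Cu : ℝ} (h : FinsetUncond e Cu) (hCu : 0 ≤ Cu)
    (F : Finset ι) (a γ : ι → ℝ) (hγ : ∀ j, |γ j| ≤ 1) :
    ‖∑ j ∈ F, (γ j * a j) • e j‖ ≤ Cu * ‖∑ j ∈ F, a j • e j‖ := by
  have hsup : (⨆ j ∈ F, |γ j|) ≤ 1 :=
    Real.iSup_le (fun j => Real.iSup_le (fun _ => hγ j) zero_le_one) zero_le_one
  calc _ ≤ Cu * (⨆ j ∈ F, |γ j|) * ‖∑ j ∈ F, a j • e j‖ := h F a γ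
    _ ≤ Cu * 1 * ‖∑ j ∈ F, a j • e j‖ := by gcongr
    _ = _ := by rw [mul_one]

theorem SeqSpreading.one_le {e : ℕ → X} {Cs : ℝ} (h : SeqSpreading e Cs) (h0 : ‖e 0‖ = 1) :
    1 ≤ Cs := by
  simpa [h0] using (h 1 1 id strictMono_id).2

theorem SeqSpreading.norm_sum_comp_le {e : ℕ → X} {Cs : ℝ} (h : SeqSpreading e Cs)
    (hCs : 0 < Cs) (m : ℕ) (a : ℕ → ℝ) {ns : ℕ → ℕ} (hns : StrictMono ns) :
    ‖∑ j ∈ Finset.range m, a j • e (ns j)‖ ≤ Cs * ‖∑ j ∈ Finset.range m, a j • e j‖ := by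
  have key := (h m a ns hns).1
  rwa [one_div, inv_mul_le_iff₀ hCs] at key

theorem norm_signed_sum_erase_le {e : ℕ → X} {Cu Cs : ℝ} (hu : FinsetUncond e Cu)
    (hs : SeqSpreading e Cs) (hCu : 0 ≤ Cu) (hCs : 0 < Cs) (ε : ℕ → Bool) {m j : ℕ}
    (hj : j ∈ Finset.range (m + 1)) :
    ‖∑ i ∈ (Finset.range (m + 1)).erase j, (if ε i then (1 : ℝ) else -1) • e i‖ ≤
      Cu * (Cs * ‖∑ i ∈ Finset.range m, e i‖) := by
  have huncond := hu.norm_sum_le hCu ((Finset.range (m + 1)).erase j) 1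
    (fun i => if ε i then 1 else -1) (fun i => by split_ifs <;> simp)
  have hmono : StrictMono fun i : ℕ => if i < j then i else i + 1 :=
    strictMono_nat_of_lt_succ fun i => by split_ifs <;> omega
  have hspread := hs.norm_sum_comp_le hCs m 1 hmono
  simp only [Pi.one_apply, mul_one, one_smul] at huncond hspread
  rw [sum_range_succ_erase e hj] at huncond
  exact huncond.trans (by gcongr)

theorem norm_sum_coeff_smul_le {e : ℕ → X} {f : ℕ → X →L[ℝ] ℝ} {Cu : ℝ}
    (hexp : ∀ x : X, NormHasSum (fun j => f j x • e j) x) (hu : FinsetUncond e Cu)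
    (hCu : 0 ≤ Cu) (F : Finset ℕ) (x : X) : ‖∑ j ∈ F, f j x • e j‖ ≤ Cu * ‖x‖ := by
  refine ge_of_tendsto ((hexp x).norm.const_mul Cu) ?_
  filter_upwards [eventually_ge_atTop (F.sup id + 1)] with N hN
  have hF : F ⊆ Finset.range N := fun i hi =>
    Finset.mem_range.mpr ((Nat.lt_succ_of_le (Finset.le_sup (f := id) hi)).trans_le hN)
  have key := hu.norm_sum_le hCu (Finset.range N) (fun j => f j x)
    (fun j => if j ∈ F then 1 else 0) (fun j => by split_ifs <;> simp)
  simpa [ite_mul, ite_smul, Finset.sum_ite_mem, Finset.inter_eq_right.mpr hF] using key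

/-- Summing all shifts of the first `m` coordinates of `x` bounds the product of the norms of
`∑ e i` and `∑ f i`. -/
theorem norm_sum_mul_norm_sum_le {e : ℕ → X} {f : ℕ → X →L[ℝ] ℝ} {Cu Cs : ℝ}
    (hexp : ∀ x : X, NormHasSum (fun j => f j x • e j) x) (hu : FinsetUncond e Cu)
    (hs : SeqSpreading e Cs) (hCu : 0 ≤ Cu) (hCs : 0 < Cs) (m : ℕ) :
    ‖∑ i ∈ Finset.range m, e i‖ * ‖∑ i ∈ Finset.range m, f i‖ ≤ 2 * Cu * Cs * m := by
  set v := ∑ i ∈ Finset.range m, e i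
  set φ := ∑ i ∈ Finset.range m, f i
  have upper (x : X) (d : ℕ) :
      ‖∑ i ∈ Finset.range (m - d), f i x • e (i + d)‖ ≤ Cs * (Cu * ‖x‖) :=
    (hs.norm_sum_comp_le hCs (m - d) (fun i => f i x)
      (strictMono_id.add_const d)).trans <| by
        gcongr; exact norm_sum_coeff_smul_le hexp hu hCu _ x
  have lower (x : X) (d : ℕ) :
      ‖∑ i ∈ Finset.range (m - (d + 1)), f (i + (d + 1)) x • e i‖ ≤ Cs * (Cu * ‖x‖) := by
    refine (hs (m - (d + 1)) (fun i => f (i + (d + 1)) x) _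
      (strictMono_id.add_const (d + 1))).2.trans ?_
    gcongr
    have key := norm_sum_coeff_smul_le hexp hu hCu
      ((Finset.range (m - (d + 1))).map (addRightEmbedding (d + 1))) x
    simpa using key
  have hφ (x : X) : ‖φ x • v‖ ≤ 2 * Cu * Cs * m * ‖x‖ := by
    have hsplit : φ x • v = ∑ i ∈ Finset.range m, ∑ j ∈ Finset.range m, f i x • e j := by
      rw [Finset.sum_comm]
      simp only [φ, v, sum_apply, Finset.sum_smul, Finset.smul_sum]
    rw [hsplit, sum_range_sum_range_eq_sum_diagonals fun i j => f i x • e j]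
    calc _ ≤ ∑ _d ∈ Finset.range m, Cs * (Cu * ‖x‖) + ∑ _d ∈ Finset.range m, Cs * (Cu * ‖x‖) :=
          (norm_add_le _ _).trans <| add_le_add
            (norm_sum_le_of_le _ fun d _ => upper x d) (norm_sum_le_of_le _ fun d _ => lower x d)
      _ = 2 * Cu * Cs * m * ‖x‖ := by
          simp only [Finset.sum_const, Finset.card_range, nsmul_eq_mul]; ring
  have hop : ‖‖v‖ • φ‖ ≤ 2 * Cu * Cs * m :=
    ContinuousLinearMap.opNorm_le_bound _ (by positivity) fun x => by
      simpa [norm_smul, mul_comm] using hφ x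
  simpa [norm_smul] using hop

end NormedSpace

/-- If `(e j)` is a normalized basis of a Banach space `X` with
biorthogonal functionals `(e j)*`, and both `(e j)` and `(e j)*` are
`(Cu,Cs)`-subsymmetric, then for every `n ≥ 2`, `τ(n) ≤ √(2·Cu³·Cs³·(n−1))`. -/
theorem tau_le_of_subsymmetric
    {X : Type*} [NormedAddCommGroup X] [NormedSpace ℝ X] [CompleteSpace X]
    (e : ℕ → X) (f : ℕ → X →L[ℝ] ℝ)
    (hnorm : ∀ j, ‖e j‖ = 1)
    (hbi : ∀ j k, f j (e k) = if k = j then 1 else 0)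
    (hexp : ∀ x : X, NormHasSum (fun j => f j x • e j) x)
    (Cu Cs : ℝ)
    (hue : FinsetUncond e Cu) (hse : SeqSpreading e Cs)
    (huf : FinsetUncond f Cu) (hsf : SeqSpreading f Cs) :
    ∀ n : ℕ, 2 ≤ n →
      tauN e f n ≤ Real.sqrt (2 * Cu ^ 3 * Cs ^ 3 * ((n : ℝ) - 1)) := by
  intro n hn
  obtain ⟨m, rfl⟩ : ∃ m, n = m + 1 := ⟨n - 1, by omega⟩
  have hCu : 0 ≤ Cu := zero_le_one.trans (hue.one_le (hnorm 0))
  have hCs : 0 < Cs := zero_lt_one.trans_le (hse.one_le (hnorm 0))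
  have hprod := norm_sum_mul_norm_sum_le hexp hue hse hCu hCs m
  set A := Cu * (Cs * ‖∑ i ∈ Finset.range m, e i‖)
  set B := Cu * (Cs * ‖∑ i ∈ Finset.range m, f i‖)
  have hA : 0 ≤ A := by positivity
  have hB : 0 ≤ B := by positivity
  refine Real.iSup_le (fun ε => ?_) (Real.sqrt_nonneg _)
  have hmin := min_le_min
    (Real.iSup_le (fun j => Real.iSup_le (fun hj : j ∈ Finset.range (m + 1) =>
      norm_signed_sum_erase_le hue hse hCu hCs (fun i => ε i j) hj) hA) hA)
    (Real.iSup_le (fun i => Real.iSup_le (fun hi : i ∈ Finset.range (m + 1) =>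
      norm_signed_sum_erase_le huf hsf hCu hCs (fun j => ε i j) hi) hB) hB)
  refine hmin.trans ?_
  refine Real.le_sqrt_of_sq_le ?_
  calc (min A B) ^ 2 = min A B * min A B := sq _
    _ ≤ A * B := mul_le_mul (min_le_left _ _) (min_le_right _ _) (le_min hA hB) hA
    _ = Cu ^ 2 * Cs ^ 2 * (‖∑ i ∈ Finset.range m, e i‖ * ‖∑ i ∈ Finset.range m, f i‖) := by
        simp only [A, B]; ring
    _ ≤ Cu ^ 2 * Cs ^ 2 * (2 * Cu * Cs * m) := by gcongr
    _ = 2 * Cu ^ 3 * Cs ^ 3 * (((m + 1 : ℕ) : ℝ) - 1) := by push_cast; ring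
end
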